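/- Under assumptions (A1) and (A3–A7), with constant step size γ > 0, for every n ≥ 1 and every t with 0 ≤ t ≤ n/2: (i) P(f(θ̄_n) − f(θ*) ≥ 30γR²t + 3‖θ_0 − θ*‖²/(γn)) ≤ 2·exp(−t); and (ii) P(‖θ_n − θ*‖² ≥ 60nγ²R²t + 6‖θ_0 − θ*‖²) ≤ 2·exp(−t), where θ̄_n = (1/n)·Σ_{k=0}^{n−1} θ_k. -/

import Mathlib

open MeasureTheory

theorem Real.exp_le_self_add_exp_sq (x : ℝ) : Real.exp x ≤ x + Real.exp (x ^ 2) := by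
  have h1 : x ^ 2 + 1 ≤ Real.exp (x ^ 2) := Real.add_one_le_exp _
  rcases le_or_gt |x| 1 with hx | hx
  · have h2 := (abs_le.1 (Real.abs_exp_sub_one_sub_id_le hx)).2
    linarith
  · rcases lt_abs.1 hx with hx | hx
    · have h2 : Real.exp x ≤ Real.exp (x ^ 2) := Real.exp_le_exp.2 (by nlinarith)
      linarith
    · have h2 : Real.exp x ≤ 1 := Real.exp_le_one_iff.2 (by linarith)
      nlinarith

theorem ConvexOn.sub_le_inner_gradient {H : Type*} [NormedAddCommGroup H]
    [InnerProductSpace ℝ H] [CompleteSpace H] {f : H → ℝ} (hf : ConvexOn ℝ Set.univ f)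
    {x : H} (hfx : DifferentiableAt ℝ f x) (y : H) :
    f x - f y ≤ inner ℝ (gradient f x) (x - y) := by
  have hline : ConvexOn ℝ Set.univ (fun s : ℝ => f (AffineMap.lineMap x y s)) :=
    hf.comp_affineMap (AffineMap.lineMap x y)
  have hderiv : HasDerivAt (fun s : ℝ => f (AffineMap.lineMap x y s))
      (inner ℝ (gradient f x) (y - x)) 0 := by
    have h1 : HasFDerivAt f (InnerProductSpace.toDual ℝ H (gradient f x))
        (AffineMap.lineMap x y (0 : ℝ)) := by
      simpa using hfx.hasGradientAt.hasFDerivAt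
    simpa [Function.comp_def] using h1.comp_hasDerivAt (0 : ℝ) AffineMap.hasDerivAt_lineMap
  have h := hline.le_slope_of_hasDerivAt (Set.mem_univ 0) (Set.mem_univ 1) one_pos hderiv
  simp only [slope_def_field, AffineMap.lineMap_apply_one, AffineMap.lineMap_apply_zero] at h
  rw [← neg_sub y x, inner_neg_right]
  linarith

theorem MeasureTheory.integral_inner_sub_condExp_eq_zero {H : Type*} [NormedAddCommGroup H]
    [InnerProductSpace ℝ H] [CompleteSpace H] {Ω : Type*} {m mΩ : MeasurableSpace Ω}
    {P : Measure Ω} [IsFiniteMeasure P] (hm : m ≤ mΩ) {z g h : Ω → H} {C : ℝ}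
    (hz : StronglyMeasurable[m] z) (hzC : ∀ᵐ ω ∂P, ‖z ω‖ ≤ C) (hg : Integrable g P)
    (hgh : P[g|m] =ᵐ[P] h) :
    Integrable (fun ω => inner ℝ (z ω) (g ω - h ω)) P ∧
      ∫ ω, inner ℝ (z ω) (g ω - h ω) ∂P = 0 := by
  have hh : Integrable h P := integrable_condExp.congr hgh
  have hzm := (hz.mono hm).aestronglyMeasurable (μ := P)
  have h1 : Integrable (fun ω => inner ℝ (z ω) (g ω)) P :=
    (innerSL ℝ : H →L[ℝ] H →L[ℝ] ℝ).integrable_of_bilin_of_bdd_left C hzm hzC hg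
  have h2 : Integrable (fun ω => inner ℝ (z ω) (h ω)) P :=
    (innerSL ℝ : H →L[ℝ] H →L[ℝ] ℝ).integrable_of_bilin_of_bdd_left C hzm hzC hh
  have hpull : P[fun ω => inner ℝ (z ω) (g ω)|m] =ᵐ[P] fun ω => inner ℝ (z ω) (P[g|m] ω) :=
    condExp_stronglyMeasurable_bilin_of_bound (innerSL ℝ : H →L[ℝ] H →L[ℝ] ℝ) hm hz hg C hzC
  have heq : ∫ ω, inner ℝ (z ω) (g ω) ∂P = ∫ ω, inner ℝ (z ω) (h ω) ∂P := by
    rw [← integral_condExp hm]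
    refine integral_congr_ae ?_
    filter_upwards [hpull, hgh] with ω h3 h4
    rw [h3, h4]
  simp only [inner_sub_right]
  exact ⟨h1.sub h2, by rw [integral_sub h1 h2, heq, sub_self]⟩

theorem MeasureTheory.integrable_exp_of_ae_le {Ω : Type*} {mΩ : MeasurableSpace Ω}
    {P : Measure Ω} [IsFiniteMeasure P] {u : Ω → ℝ} {C : ℝ} (hu : AEStronglyMeasurable u P)
    (huC : ∀ᵐ ω ∂P, u ω ≤ C) : Integrable (fun ω => Real.exp (u ω)) P := by
  refine Integrable.of_bound (Real.continuous_exp.comp_aestronglyMeasurable hu) (Real.exp C) ?_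
  filter_upwards [huC] with ω hω
  rw [Real.norm_eq_abs, Real.abs_exp]
  exact Real.exp_le_exp.2 hω

/-- One gradient step: the exponential moment of the new potential `B`, at the inverse temperature
`lam`, is controlled by that of the old potential `‖x‖² + A`, at the larger value `lam'`. -/
theorem integral_exp_gradient_step_le {H : Type*} [NormedAddCommGroup H]
    [InnerProductSpace ℝ H] [CompleteSpace H] {Ω : Type*} {m mΩ : MeasurableSpace Ω}
    {P : Measure Ω} [IsFiniteMeasure P] (hm : m ≤ mΩ) {x g h : Ω → H} {A B : Ω → ℝ}
    {C R γ lam lam' : ℝ}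
    (hx : StronglyMeasurable[m] x) (hxC : ∀ᵐ ω ∂P, ‖x ω‖ ≤ C)
    (hA : StronglyMeasurable[m] A) (hA0 : ∀ᵐ ω ∂P, 0 ≤ A ω) (hAC : ∀ᵐ ω ∂P, A ω ≤ C)
    (hg : AEStronglyMeasurable g P) (hgR : ∀ᵐ ω ∂P, ‖g ω‖ ≤ R) (hhR : ∀ᵐ ω ∂P, ‖h ω‖ ≤ R)
    (hgh : P[g|m] =ᵐ[P] h)
    (hB : ∀ᵐ ω ∂P, B ω ≤ ‖x ω - γ • g ω‖ ^ 2 + A ω + 2 * γ * inner ℝ (x ω) (h ω))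
    (hlam : 0 ≤ lam) (hlam' : lam + 16 * γ ^ 2 * R ^ 2 * lam ^ 2 ≤ lam') :
    ∫ ω, Real.exp (lam * B ω) ∂P ≤
      Real.exp (lam * (γ ^ 2 * R ^ 2)) * ∫ ω, Real.exp (lam' * (‖x ω‖ ^ 2 + A ω)) ∂P := by
  have hlam_le : lam ≤ lam' := by
    have : 0 ≤ 16 * γ ^ 2 * R ^ 2 * lam ^ 2 := by positivity
    linarith
  set w : Ω → ℝ := fun ω => Real.exp (lam * (‖x ω‖ ^ 2 + A ω)) with hw
  set z : Ω → H := fun ω => (w ω * (-2 * γ * lam)) • x ω with hz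
  have hwm : StronglyMeasurable[m] w :=
    Real.continuous_exp.comp_stronglyMeasurable (((hx.norm.pow 2).add hA).const_mul lam)
  have hzm : StronglyMeasurable[m] z := (hwm.mul_const _).smul hx
  have hzC : ∀ᵐ ω ∂P, ‖z ω‖ ≤ Real.exp (lam * (C ^ 2 + C)) * |-2 * γ * lam| * C := by
    filter_upwards [hxC, hAC] with ω h1 h2
    rw [hz, norm_smul, norm_mul, Real.norm_eq_abs, Real.norm_eq_abs, Real.abs_exp]
    gcongr
  have hgint : Integrable g P := Integrable.of_bound hg R hgR
  obtain ⟨hint, hzero⟩ := integral_inner_sub_condExp_eq_zero hm hzm hzC hgint hgh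
  have hint' : Integrable (fun ω => Real.exp (lam' * (‖x ω‖ ^ 2 + A ω))) P := by
    refine integrable_exp_of_ae_le (C := lam' * (C ^ 2 + C))
      ((((hx.norm.pow 2).add hA).const_mul lam').mono hm).aestronglyMeasurable ?_
    filter_upwards [hxC, hAC] with ω h1 h2
    have := hlam.trans hlam_le
    gcongr
  calc ∫ ω, Real.exp (lam * B ω) ∂P
      ≤ ∫ ω, Real.exp (lam * (γ ^ 2 * R ^ 2)) * (inner ℝ (z ω) (g ω - h ω) +
          Real.exp (lam' * (‖x ω‖ ^ 2 + A ω))) ∂P := by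
        refine integral_mono_of_nonneg (ae_of_all _ fun _ => (Real.exp_pos _).le)
          ((hint.add hint').const_mul _) ?_
        filter_upwards [hB, hA0, hgR, hhR] with ω hBω hA0ω hgω hhω
        set X : ℝ := -2 * γ * lam * inner ℝ (x ω) (g ω - h ω) with hX
        have hR0 : 0 ≤ R := (norm_nonneg _).trans hgω
        have hXsq : X ^ 2 ≤ 16 * γ ^ 2 * R ^ 2 * lam ^ 2 * ‖x ω‖ ^ 2 := by
          have h1 : |inner ℝ (x ω) (g ω - h ω)| ≤ ‖x ω‖ * (2 * R) := by
            refine (abs_real_inner_le_norm _ _).trans ?_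
            gcongr
            exact (norm_sub_le _ _).trans (by linarith)
          have h2 : (inner ℝ (x ω) (g ω - h ω)) ^ 2 ≤ (‖x ω‖ * (2 * R)) ^ 2 :=
            sq_le_sq' (abs_le.1 h1).1 (abs_le.1 h1).2
          calc X ^ 2 = (4 * γ ^ 2 * lam ^ 2) * (inner ℝ (x ω) (g ω - h ω)) ^ 2 := by
                rw [hX]; ring
            _ ≤ (4 * γ ^ 2 * lam ^ 2) * (‖x ω‖ * (2 * R)) ^ 2 := by gcongr
            _ = _ := by ring
        have hexpo : lam * B ω ≤ lam * (γ ^ 2 * R ^ 2) + (lam * (‖x ω‖ ^ 2 + A ω) + X) := by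
          have h1 : ‖g ω‖ ^ 2 ≤ R ^ 2 := by gcongr
          have h2 : B ω ≤ ‖x ω‖ ^ 2 + A ω - 2 * γ * inner ℝ (x ω) (g ω - h ω) +
              γ ^ 2 * R ^ 2 := by
            refine hBω.trans ?_
            rw [norm_sub_sq_real, inner_smul_right, norm_smul, mul_pow, Real.norm_eq_abs, sq_abs,
              inner_sub_right]
            have := mul_le_mul_of_nonneg_left h1 (sq_nonneg γ)
            linarith
          have := mul_le_mul_of_nonneg_left h2 hlam
          rw [hX]
          linarith
        have hquad : lam * (‖x ω‖ ^ 2 + A ω) + X ^ 2 ≤ lam' * (‖x ω‖ ^ 2 + A ω) := by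
          have h1 := mul_le_mul_of_nonneg_right hlam' (sq_nonneg ‖x ω‖)
          have h2 := mul_le_mul_of_nonneg_right hlam_le hA0ω
          linarith
        have hzX : inner ℝ (z ω) (g ω - h ω) = w ω * X := by
          rw [hz, hX, real_inner_smul_left]; ring
        calc Real.exp (lam * B ω)
            ≤ Real.exp (lam * (γ ^ 2 * R ^ 2)) * (w ω * Real.exp X) := by
              rw [hw, ← Real.exp_add, ← Real.exp_add]
              exact Real.exp_le_exp.2 hexpo
          _ ≤ Real.exp (lam * (γ ^ 2 * R ^ 2)) * (w ω * (X + Real.exp (X ^ 2))) := by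
              have := Real.exp_le_self_add_exp_sq X
              have : 0 ≤ w ω := (Real.exp_pos _).le
              gcongr
          _ ≤ _ := by
              rw [hzX, mul_add (w ω)]
              gcongr
              rw [hw, ← Real.exp_add]
              exact Real.exp_le_exp.2 hquad
    _ = _ := by
        rw [integral_const_mul, integral_add hint hint', hzero, zero_add]

/-- The squared distance of the `k`-th iterate to `θstar`, plus `2γ` times the accumulated
excess of `f` along the previous iterates. -/
noncomputable def sgdPotential {H : Type*} [NormedAddCommGroup H] {Ω : Type*} (f : H → ℝ)
    (θstar : H) (γ : ℝ) (θ : ℕ → Ω → H) (k : ℕ) (ω : Ω) : ℝ :=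
  ‖θ k ω - θstar‖ ^ 2 + ∑ j ∈ Finset.range k, 2 * γ * (f (θ j ω) - f θstar)

theorem measure_le_sgdPotential_le
    {H : Type*} [NormedAddCommGroup H] [InnerProductSpace ℝ H] [CompleteSpace H]
    {Ω : Type*} {mΩ : MeasurableSpace Ω} {P : Measure Ω} [IsProbabilityMeasure P]
    (ℱ : Filtration ℕ mΩ) {f : H → ℝ} {θstar θ0 : H} {R γ : ℝ} {θ g : ℕ → Ω → H}
    (hR : 0 < R) (hγ : 0 < γ)
    (hf_conv : ConvexOn ℝ Set.univ f) (hf_diff : Differentiable ℝ f)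
    (hmin : ∀ θ' : H, f θstar ≤ f θ') (hf_grad_bound : ∀ θ' : H, ‖gradient f θ'‖ ≤ R)
    (hg_bound : ∀ k, ∀ᵐ ω ∂P, ‖g k ω‖ ≤ R)
    (hθ_adapted : ∀ k, StronglyMeasurable[ℱ k] (θ k))
    (hunbiased : ∀ k, P[g k|ℱ k] =ᵐ[P] fun ω => gradient f (θ k ω))
    (hθ0 : ∀ ω, θ 0 ω = θ0) (hrec : ∀ k ω, θ (k + 1) ω = θ k ω - γ • g k ω)
    {n : ℕ} (hn : 1 ≤ n) {t : ℝ} (ht0 : 0 ≤ t) :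
    P {ω | 60 * n * γ ^ 2 * R ^ 2 * t + 6 * ‖θ0 - θstar‖ ^ 2 ≤ sgdPotential f θstar γ θ n ω}
      ≤ ENNReal.ofReal (2 * Real.exp (-t)) := by
  set A : ℕ → Ω → ℝ :=
    fun k ω => ∑ j ∈ Finset.range k, 2 * γ * (f (θ j ω) - f θstar) with hA
  have hA0 : ∀ k ω, 0 ≤ A k ω := fun k ω =>
    Finset.sum_nonneg fun j _ => mul_nonneg (by positivity) (sub_nonneg.2 (hmin _))
  have hfθ : ∀ j k, j ≤ k → StronglyMeasurable[ℱ k] fun ω => f (θ j ω) := fun j k hjk =>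
    hf_diff.continuous.comp_stronglyMeasurable ((hθ_adapted j).mono (ℱ.mono hjk))
  have hAm : ∀ k, StronglyMeasurable[ℱ k] (A k) := fun k =>
    Finset.stronglyMeasurable_fun_sum _ fun j hj =>
      ((hfθ j k (Finset.mem_range.1 hj).le).sub stronglyMeasurable_const).const_mul _
  have hxm : ∀ k, StronglyMeasurable[ℱ k] fun ω => θ k ω - θstar := fun k =>
    (hθ_adapted k).sub stronglyMeasurable_const
  have hYm : ∀ k, StronglyMeasurable[ℱ k] (sgdPotential f θstar γ θ k) := fun k =>
    ((hxm k).norm.pow 2).add (hAm k)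
  have hgm : ∀ k, AEStronglyMeasurable (g k) P := fun k => by
    have h1 : g k = fun ω => γ⁻¹ • (θ k ω - θ (k + 1) ω) := by
      ext1 ω
      rw [hrec, sub_sub_cancel, inv_smul_smul₀ hγ.ne']
    rw [h1]
    exact ((((hθ_adapted k).mono (ℱ.le k)).sub
      ((hθ_adapted (k + 1)).mono (ℱ.le _))).const_smul _).aestronglyMeasurable
  have hgrad : ∀ k ω, f (θ k ω) - f θstar ≤ inner ℝ (θ k ω - θstar) (gradient f (θ k ω)) :=
    fun k ω => by
      rw [real_inner_comm]
      exact hf_conv.sub_le_inner_gradient (hf_diff _) _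
  have hbound : ∀ k, ∃ C, ∀ᵐ ω ∂P, ‖θ k ω - θstar‖ ≤ C ∧ A k ω ≤ C := by
    intro k
    induction k with
    | zero =>
      refine ⟨‖θ0 - θstar‖, ae_of_all _ fun ω => ?_⟩
      simp [hA, hθ0]
    | succ k ih =>
      obtain ⟨C, hC⟩ := ih
      refine ⟨max (C + γ * R) (C + 2 * γ * (C * R)), ?_⟩
      filter_upwards [hC, hg_bound k] with ω h1 h2
      constructor
      · refine le_max_of_le_left ?_
        rw [hrec, sub_right_comm]
        refine (norm_sub_le _ _).trans (add_le_add h1.1 ?_)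
        rw [norm_smul, Real.norm_of_nonneg hγ.le]
        gcongr
      · refine le_max_of_le_right ?_
        simp only [hA, Finset.sum_range_succ]
        refine add_le_add h1.2 (mul_le_mul_of_nonneg_left ((hgrad k ω).trans
          ((real_inner_le_norm _ _).trans ?_)) (by positivity))
        exact mul_le_mul h1.1 (hf_grad_bound _) (norm_nonneg _) ((norm_nonneg _).trans h1.1)
  have hn0 : (0 : ℝ) < n := by exact_mod_cast hn
  set c : ℝ := 16 * γ ^ 2 * R ^ 2 with hc
  have hc0 : 0 < c := by positivity
  set lam : ℕ → ℝ := fun k => 1 / (c * (n + k)) with hlam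
  have hlam0 : ∀ k, 0 < lam k := fun k => by simp only [hlam]; positivity
  have hlam_step : ∀ k, lam (k + 1) + c * lam (k + 1) ^ 2 ≤ lam k := fun k => by
    simp only [hlam]
    push_cast
    rw [div_pow, mul_div_assoc', div_add_div _ _ (by positivity) (by positivity),
      div_le_div_iff₀ (by positivity) (by positivity)]
    have hs : (0 : ℝ) < n + k := by positivity
    rw [← add_assoc]
    set s : ℝ := n + k
    have : 0 ≤ c ^ 3 * (s + 1) := by positivity
    nlinarith
  have hlam_le : ∀ k, lam k ≤ lam 0 := fun k => by
    simp only [hlam]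
    gcongr
    simp
  have hmoment : ∀ k, ∫ ω, Real.exp (lam k * sgdPotential f θstar γ θ k ω) ∂P ≤
      Real.exp (lam 0 * ‖θ0 - θstar‖ ^ 2 + k * (lam 0 * (γ ^ 2 * R ^ 2))) := by
    intro k
    induction k with
    | zero => simp [sgdPotential, hθ0]
    | succ k ih =>
      obtain ⟨C, hC⟩ := hbound k
      refine (integral_exp_gradient_step_le (ℱ.le k) (hxm k) (hC.mono fun _ h => h.1) (hAm k)
        (ae_of_all _ (hA0 k)) (hC.mono fun _ h => h.2) (hgm k) (hg_bound k)
        (ae_of_all _ fun ω => hf_grad_bound _) (hunbiased k) (γ := γ) ?_ (hlam0 (k + 1)).le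
        (hlam_step k)).trans ?_
      · refine ae_of_all _ fun ω => ?_
        simp only [sgdPotential, hA, Finset.sum_range_succ]
        rw [hrec, sub_right_comm]
        have := mul_le_mul_of_nonneg_left (hgrad k ω) (by positivity : 0 ≤ 2 * γ)
        linarith
      · refine (mul_le_mul_of_nonneg_left ih (Real.exp_pos _).le).trans ?_
        rw [← Real.exp_add]
        refine Real.exp_le_exp.2 ?_
        have := mul_le_mul_of_nonneg_right (hlam_le (k + 1))
          (by positivity : 0 ≤ γ ^ 2 * R ^ 2)
        push_cast
        linarith
  have hint : Integrable (fun ω => Real.exp (lam n * sgdPotential f θstar γ θ n ω)) P := by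
    obtain ⟨C, hC⟩ := hbound n
    refine integrable_exp_of_ae_le (C := lam n * (C ^ 2 + C))
      (((hYm n).mono (ℱ.le n)).const_mul _).aestronglyMeasurable ?_
    filter_upwards [hC] with ω h
    refine mul_le_mul_of_nonneg_left (add_le_add ?_ h.2) (hlam0 n).le
    exact pow_le_pow_left₀ (norm_nonneg _) h.1 2
  set y : ℝ := 60 * n * γ ^ 2 * R ^ 2 * t + 6 * ‖θ0 - θstar‖ ^ 2 with hy
  have hmarkov := (mul_meas_ge_le_integral_of_nonneg
    (ae_of_all P fun ω => (Real.exp_pos (lam n * sgdPotential f θstar γ θ n ω)).le)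
    hint (Real.exp (lam n * y))).trans (hmoment n)
  have hset : {ω | Real.exp (lam n * y) ≤ Real.exp (lam n * sgdPotential f θstar γ θ n ω)} =
      {ω | y ≤ sgdPotential f θstar γ θ n ω} := by
    ext ω
    simp only [Set.mem_ofPred_eq, Real.exp_le_exp, mul_le_mul_iff_right₀ (hlam0 n)]
  rw [hset] at hmarkov
  have hexpo : lam 0 * ‖θ0 - θstar‖ ^ 2 + n * (lam 0 * (γ ^ 2 * R ^ 2)) ≤
      lam n * y + (Real.log 2 + -t) := by
    have h1 : n * (lam 0 * (γ ^ 2 * R ^ 2)) = 1 / 16 := by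
      simp only [hlam, hc]
      push_cast
      field_simp
      ring
    have h2 : lam n * y = 15 / 8 * t + 3 * (lam 0 * ‖θ0 - θstar‖ ^ 2) := by
      simp only [hlam, hc, hy]
      push_cast
      field_simp
      ring
    have h3 : 0 ≤ lam 0 * ‖θ0 - θstar‖ ^ 2 := mul_nonneg (hlam0 0).le (sq_nonneg _)
    have h4 := Real.log_two_gt_d9
    linarith
  rw [← ofReal_measureReal]
  refine ENNReal.ofReal_le_ofReal ?_
  have h2 := hmarkov.trans (Real.exp_le_exp.2 hexpo)
  rw [Real.exp_add, Real.exp_add, Real.exp_log two_pos] at h2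
  exact le_of_mul_le_mul_left h2 (Real.exp_pos _)

theorem bach_prop_dev
    {H : Type*} [NormedAddCommGroup H] [InnerProductSpace ℝ H] [CompleteSpace H]
    {Ω : Type*} {mΩ : MeasurableSpace Ω} {P : Measure Ω} [IsProbabilityMeasure P]
    (ℱ : Filtration ℕ mΩ)
    (f : H → ℝ) (F : ℕ → Ω → H → ℝ) (θstar θ0 : H) (R γ : ℝ)
    (θ : ℕ → Ω → H)
    (hR : 0 < R)
    (hγ : 0 < γ)
    -- (A1) convexity and differentiability of f
    (hf_conv : ConvexOn ℝ Set.univ f)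
    (hf_diff : Differentiable ℝ f)
    -- (A3) attained global minimum
    (hmin : ∀ θ' : H, f θstar ≤ f θ')
    -- (A4) Lipschitz-continuity of f and the fₙ
    (hf_grad_bound : ∀ θ' : H, ‖gradient f θ'‖ ≤ R)
    (hF_grad_bound : ∀ n : ℕ, ∀ᵐ ω ∂P, ∀ θ' : H, ‖gradient (F n ω) θ'‖ ≤ R)
    (hF_conv : ∀ n ω, ConvexOn ℝ Set.univ (F n ω))
    (hF_diff : ∀ n ω, Differentiable ℝ (F n ω))
    -- (A5) adapted measurability
    (hF_meas : ∀ n : ℕ, ∀ x : H, StronglyMeasurable[ℱ n] (fun ω => F n ω x))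
    (hθ_adapted : ∀ n : ℕ, StronglyMeasurable[ℱ n] (θ n))
    -- (A6) unbiased gradients
    (hunbiased : ∀ n : ℕ, 1 ≤ n →
      P[(fun ω => gradient (F n ω) (θ (n - 1) ω))|ℱ (n - 1)]
        =ᵐ[P] fun ω => gradient f (θ (n - 1) ω))
    -- (A7) stochastic gradient recursion
    (hθ0 : ∀ ω, θ 0 ω = θ0)
    (hrec : ∀ n : ℕ, 1 ≤ n → ∀ ω,
      θ n ω = θ (n - 1) ω - γ • gradient (F n ω) (θ (n - 1) ω))
    (n : ℕ) (hn : 1 ≤ n) (t : ℝ) (ht0 : 0 ≤ t) (ht : t ≤ n / 2)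
    :
    (P {ω | f (((n : ℝ))⁻¹ • ∑ k ∈ Finset.range n, θ k ω) - f θstar
          ≥ 30 * γ * R ^ 2 * t + 3 * ‖θ0 - θstar‖ ^ 2 / (γ * n)}
        ≤ ENNReal.ofReal (2 * Real.exp (-t))) ∧
    (P {ω | ‖θ n ω - θstar‖ ^ 2 ≥ 60 * n * γ ^ 2 * R ^ 2 * t + 6 * ‖θ0 - θstar‖ ^ 2}
        ≤ ENNReal.ofReal (2 * Real.exp (-t))) := by
  have htail := measure_le_sgdPotential_le ℱ
    (g := fun k ω => gradient (F (k + 1) ω) (θ k ω)) hR hγ hf_conv hf_diff hmin hf_grad_bound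
    (fun k => (hF_grad_bound (k + 1)).mono fun ω h => h _) hθ_adapted
    (fun k => hunbiased (k + 1) k.succ_pos) hθ0 (fun k ω => hrec (k + 1) k.succ_pos ω) hn ht0
  have hn0 : (0 : ℝ) < n := by exact_mod_cast hn
  refine ⟨(measure_mono fun ω hω => ?_).trans htail, (measure_mono fun ω hω => ?_).trans htail⟩
  · simp only [Set.mem_ofPred_eq, ge_iff_le] at hω ⊢
    have hjensen : f ((n : ℝ)⁻¹ • ∑ k ∈ Finset.range n, θ k ω) ≤
        (n : ℝ)⁻¹ * ∑ k ∈ Finset.range n, f (θ k ω) := by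
      rw [Finset.smul_sum, Finset.mul_sum]
      exact hf_conv.map_sum_le (fun _ _ => by positivity) (by simp [hn0.ne'])
        (fun _ _ => Set.mem_univ _)
    have hsum : ∑ k ∈ Finset.range n, 2 * γ * (f (θ k ω) - f θstar) =
        2 * γ * n * ((n : ℝ)⁻¹ * ∑ k ∈ Finset.range n, f (θ k ω) - f θstar) := by
      rw [← Finset.mul_sum, Finset.sum_sub_distrib, Finset.sum_const, Finset.card_range,
        nsmul_eq_mul]
      field_simp
    have hy : 60 * n * γ ^ 2 * R ^ 2 * t + 6 * ‖θ0 - θstar‖ ^ 2 =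
        2 * γ * n * (30 * γ * R ^ 2 * t + 3 * ‖θ0 - θstar‖ ^ 2 / (γ * n)) := by
      field_simp
      ring
    rw [sgdPotential, hsum, hy]
    refine le_add_of_nonneg_of_le (sq_nonneg _) (mul_le_mul_of_nonneg_left ?_ (by positivity))
    linarith
  · exact le_add_of_le_of_nonneg hω (Finset.sum_nonneg fun j _ =>
      mul_nonneg (by positivity) (sub_nonneg.2 (hmin _)))
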